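/- Let u ∈ Γ and s,t ∈ [1,n] with s < t, u_s < u_t, and u_j ∉ [u_s, u_t] for all j ∈ [s+1,t−1], and set v = Swap(u,s,t). Then (u,v) is a covering pair of the poset (Γ, ≼_US): u ≺_US v, and every w ∈ Γ with u ≼_US w ≼_US v satisfies w ∈ {u,v}. -/

import Mathlib

open Finset

/-- `Up u s` increases the `s`-th entry of the PV sequence `u` by one. -/
def Up {n : ℕ} (u : Fin n → ℕ) (s : Fin n) : Fin n → ℕ :=
  fun j => if j = s then u s + 1 else u j

/-- `Move u s t` moves one pageview from period `t` to the more recent period `s`. -/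
def Move {n : ℕ} (u : Fin n → ℕ) (s t : Fin n) : Fin n → ℕ :=
  fun j => if j = s then u s + 1 else if j = t then u t - 1 else u j

/-- `Swap u s t` exchanges the entries of `u` at positions `s` and `t`. -/
def Swap {n : ℕ} (u : Fin n → ℕ) (s t : Fin n) : Fin n → ℕ :=
  fun j => if j = s then u t else if j = t then u s else u j

/-- Membership in `Γ = {0,1,...,m}^n`. -/
def InGamma {n : ℕ} (m : ℕ) (u : Fin n → ℕ) : Prop := ∀ j, u j ≤ m

/-- Strict lexicographic order: `u ≺_lex v` iff there is `s` with `u s < v s`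
and `u j = v j` for all `j < s`. -/
def LexLt {n : ℕ} (u v : Fin n → ℕ) : Prop :=
  ∃ s : Fin n, u s < v s ∧ ∀ j : Fin n, j < s → u j = v j

/-- `u ≼_lex v` iff `u ≺_lex v` or `u = v`. -/
def LexLe {n : ℕ} (u v : Fin n → ℕ) : Prop := LexLt u v ∨ u = v

/-- One step of the `Up`/`Move` relation. -/
def UMStep {n : ℕ} (m : ℕ) (u v : Fin n → ℕ) : Prop :=
  (∃ s : Fin n, u s ≤ m - 1 ∧ v = Up u s) ∨
  (∃ s t : Fin n, s < t ∧ u s ≤ m - 1 ∧ 1 ≤ u t ∧ v = Move u s t)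

/-- `u ≺_UM v`: transitive closure of the `Up`/`Move` steps. -/
def UMLt {n : ℕ} (m : ℕ) : (Fin n → ℕ) → (Fin n → ℕ) → Prop :=
  Relation.TransGen (UMStep m)

/-- `u ≼_UM v` iff `u ≺_UM v` or `u = v`. -/
def UMLe {n : ℕ} (m : ℕ) (u v : Fin n → ℕ) : Prop := UMLt m u v ∨ u = v

/-- One step of the `Up`/`Swap` relation. -/
def USStep {n : ℕ} (m : ℕ) (u v : Fin n → ℕ) : Prop :=
  (∃ s : Fin n, u s ≤ m - 1 ∧ v = Up u s) ∨
  (∃ s t : Fin n, s < t ∧ u s < u t ∧ v = Swap u s t)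

/-- `u ≺_US v`: transitive closure of the `Up`/`Swap` steps. -/
def USLt {n : ℕ} (m : ℕ) : (Fin n → ℕ) → (Fin n → ℕ) → Prop :=
  Relation.TransGen (USStep m)

/-- `u ≼_US v` iff `u ≺_US v` or `u = v`. -/
def USLe {n : ℕ} (m : ℕ) (u v : Fin n → ℕ) : Prop := USLt m u v ∨ u = v

/-- The number of positions before `k` whose entry in `w` is at least `a`. -/
def prefixCount {n : ℕ} (w : Fin n → ℕ) (k a : ℕ) : ℕ :=
  ∑ j : Fin n, if j.val < k ∧ a ≤ w j then 1 else 0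

theorem prefixCount_succ {n : ℕ} (w : Fin n → ℕ) (j : Fin n) (a : ℕ) :
    prefixCount w (j.val + 1) a = prefixCount w j.val a + if a ≤ w j then 1 else 0 := by
  have h : (∑ i : Fin n, if i = j then (if a ≤ w j then 1 else 0) else 0) =
      if a ≤ w j then 1 else 0 := by simp
  rw [prefixCount, prefixCount, ← h, ← Finset.sum_add_distrib]
  refine Finset.sum_congr rfl fun i _ => ?_
  by_cases hij : i = j
  · subst hij
    simp
  · have : i.val ≠ j.val := fun h => hij (Fin.ext h)
    have : i.val < j.val + 1 ↔ i.val < j.val := by omega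
    simp [hij, this]

theorem prefixCount_eq_add {n : ℕ} (w : Fin n → ℕ) {s t : Fin n} (hst : s ≠ t) (k a : ℕ) :
    prefixCount w k a =
      (if s.val < k ∧ a ≤ w s then 1 else 0) + (if t.val < k ∧ a ≤ w t then 1 else 0) +
        ∑ j ∈ (univ.erase s).erase t, if j.val < k ∧ a ≤ w j then 1 else 0 := by
  rw [prefixCount, ← Finset.add_sum_erase _ _ (mem_univ s),
    ← Finset.add_sum_erase _ _ (mem_erase.2 ⟨hst.symm, mem_univ t⟩), add_assoc]

/-- Sequences that agree off `s` and `t` have prefix counts differing only by the contributions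
of `s` and `t`. -/
theorem prefixCount_add_eq_of_agree {n : ℕ} {u w : Fin n → ℕ} {s t : Fin n} (hst : s ≠ t)
    (h : ∀ j, j ≠ s → j ≠ t → w j = u j) (k a : ℕ) :
    prefixCount w k a +
        ((if s.val < k ∧ a ≤ u s then 1 else 0) + (if t.val < k ∧ a ≤ u t then 1 else 0)) =
      prefixCount u k a +
        ((if s.val < k ∧ a ≤ w s then 1 else 0) + (if t.val < k ∧ a ≤ w t then 1 else 0)) := by
  rw [prefixCount_eq_add w hst, prefixCount_eq_add u hst]
  have : (∑ j ∈ (univ.erase s).erase t, if j.val < k ∧ a ≤ w j then 1 else 0) =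
      ∑ j ∈ (univ.erase s).erase t, if j.val < k ∧ a ≤ u j then 1 else 0 := by
    refine Finset.sum_congr rfl fun j hj => ?_
    simp only [mem_erase, mem_univ, and_true] at hj
    rw [h j hj.2 hj.1]
  omega

theorem Swap_left {n : ℕ} (u : Fin n → ℕ) (s t : Fin n) : Swap u s t s = u t := by
  simp [Swap]

theorem Swap_right {n : ℕ} (u : Fin n → ℕ) {s t : Fin n} (hst : s < t) :
    Swap u s t t = u s := by
  simp [Swap, hst.ne']

theorem Swap_of_ne {n : ℕ} (u : Fin n → ℕ) {s t j : Fin n} (hs : j ≠ s) (ht : j ≠ t) :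
    Swap u s t j = u j := by
  simp [Swap, hs, ht]

theorem prefixCount_Swap_add {n : ℕ} (u : Fin n → ℕ) {s t : Fin n} (hst : s < t) (k a : ℕ) :
    prefixCount (Swap u s t) k a +
        ((if s.val < k ∧ a ≤ u s then 1 else 0) + (if t.val < k ∧ a ≤ u t then 1 else 0)) =
      prefixCount u k a +
        ((if s.val < k ∧ a ≤ u t then 1 else 0) + (if t.val < k ∧ a ≤ u s then 1 else 0)) := by
  have h := prefixCount_add_eq_of_agree hst.ne (fun j => Swap_of_ne u) k a
  rwa [Swap_left, Swap_right u hst] at h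

theorem USStep.prefixCount_le {n m : ℕ} {u v : Fin n → ℕ} (h : USStep m u v) (k a : ℕ) :
    prefixCount u k a ≤ prefixCount v k a := by
  rcases h with ⟨s, -, rfl⟩ | ⟨s, t, hst, hut, rfl⟩
  · refine Finset.sum_le_sum fun j _ => ?_
    have : u j ≤ Up u s j := by
      by_cases hj : j = s <;> simp [Up, hj]
    split_ifs <;> omega
  · have h := prefixCount_Swap_add u hst k a
    have := Fin.lt_def.1 hst
    split_ifs at h <;> omega

theorem USLe.prefixCount_le {n m : ℕ} {u v : Fin n → ℕ} (h : USLe m u v) (k a : ℕ) :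
    prefixCount u k a ≤ prefixCount v k a := by
  rcases h with h | rfl
  · induction h with
    | single h => exact h.prefixCount_le k a
    | tail _ h ih => exact ih.trans (h.prefixCount_le k a)
  · exact le_rfl

theorem le_iff_le_of_prefixCount_eq {n : ℕ} {u w : Fin n → ℕ} {j : Fin n} {a : ℕ}
    (h₀ : prefixCount w j.val a = prefixCount u j.val a)
    (h₁ : prefixCount w (j.val + 1) a = prefixCount u (j.val + 1) a) :
    a ≤ w j ↔ a ≤ u j := by
  rw [prefixCount_succ, prefixCount_succ, h₀] at h₁
  split_ifs at h₁ <;> omega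

theorem stmt_17 (n m : ℕ) (hn : 0 < n) (hm : 0 < m)
    (u : Fin n → ℕ) (hu : InGamma m u) (s t : Fin n) (hst : s < t)
    (hut : u s < u t)
    (hcond : ∀ j : Fin n, s < j → j < t → ¬(u s ≤ u j ∧ u j ≤ u t))
    (v : Fin n → ℕ) (hv : v = Swap u s t) :
    USLt m u v ∧
      ∀ w : Fin n → ℕ, InGamma m w → USLe m u w → USLe m w v → (w = u ∨ w = v) := by
  refine ⟨.single (.inr ⟨s, t, hst, hut, hv⟩), fun w _ huw hwv => ?_⟩
  subst hv
  have hst' := Fin.lt_def.1 hst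
  have count_eq : ∀ k a : ℕ, k ≤ s.val ∨ t.val < k ∨ a ≤ u s ∨ u t < a →
      prefixCount w k a = prefixCount u k a := by
    intro k a hk
    have h₁ := huw.prefixCount_le k a
    have h₂ := hwv.prefixCount_le k a
    have h₃ := prefixCount_Swap_add u hst k a
    split_ifs at h₃ <;> omega
  have le_iff : ∀ (j : Fin n) (a : ℕ), j < s ∨ t < j ∨ a ≤ u s ∨ u t < a →
      (a ≤ w j ↔ a ≤ u j) := by
    intro j a hj
    simp only [Fin.lt_def] at hj
    exact le_iff_le_of_prefixCount_eq (count_eq _ _ (by omega)) (count_eq _ _ (by omega))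
  have agree : ∀ j, j ≠ s → j ≠ t → w j = u j := by
    intro j hjs hjt
    have h₁ := le_iff j (w j)
    have h₂ := le_iff j (u j)
    rcases lt_or_gt_of_ne hjs with hs | hs
    · have := h₁ (.inl hs)
      have := h₂ (.inl hs)
      omega
    rcases lt_or_gt_of_ne hjt with ht | ht
    · have := hcond j hs ht
      have := le_iff j (u s) (by omega)
      have := le_iff j (u t + 1) (by omega)
      omega
    · have := h₁ (.inr (.inl ht))
      have := h₂ (.inr (.inl ht))
      omega
  have pair : ∀ a : ℕ, (if a ≤ u s then 1 else 0) + (if a ≤ u t then 1 else 0) =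
      (if a ≤ w s then 1 else 0) + (if a ≤ w t then 1 else 0) := by
    intro a
    have h := prefixCount_add_eq_of_agree hst.ne agree (t.val + 1) a
    rw [count_eq _ _ (by omega)] at h
    simpa [Nat.lt_succ_of_lt hst'] using h
  have ends : (w s = u s ∧ w t = u t) ∨ (w s = u t ∧ w t = u s) := by
    have h₁ := pair (w s)
    have h₂ := pair (w t)
    have h₃ := pair (u s)
    have h₄ := pair (u t)
    have h₅ := pair (u s + 1)
    have h₆ := pair (u t + 1)
    grind
  rcases ends with ⟨hs, ht⟩ | ⟨hs, ht⟩
  · left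
    funext j
    by_cases hjs : j = s
    · rw [hjs, hs]
    by_cases hjt : j = t
    · rw [hjt, ht]
    exact agree j hjs hjt
  · right
    funext j
    by_cases hjs : j = s
    · rw [hjs, hs, Swap_left]
    by_cases hjt : j = t
    · rw [hjt, ht, Swap_right u hst]
    rw [agree j hjs hjt, Swap_of_ne u hjs hjt]
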